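/- arXiv:2006.16347 — 6 statements merged into one kernel-verified Lean document; each statement's English description precedes it below -/
import Mathlib

section
/- Let d ≥ 1 and let ℙ be a probability measure on Ω = ℝ^{E^d} satisfying assumption A. Then ℙ-almost surely, for every x ∈ ℤ^d the subgraph C_x of the directed nearest neighbor graph N_D induced by the vertices y admitting a directed path from y to x is finite (it has finitely many vertices). -/
open MeasureTheory

/-- Vertices of the cubic lattice `ℤ^d`. -/
abbrev Vd (d : ℕ) := Fin d → ℤ

/-- Lattice adjacency: `‖x - y‖₁ = 1`. -/
def latAdj {d : ℕ} (x y : Vd d) : Prop := (∑ i, |x i - y i|) = 1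

/-- `e` is an edge of the cubic lattice. -/
def IsLatEdge {d : ℕ} (e : Sym2 (Vd d)) : Prop := ∃ x y : Vd d, latAdj x y ∧ e = s(x, y)

/-- The edge set `E^d` of the cubic lattice, as a type. -/
abbrev LatEdge (d : ℕ) := {e : Sym2 (Vd d) // IsLatEdge e}

/-- The configuration space `Ω = ℝ^{E^d}` (with the product Borel σ-algebra). -/
abbrev Omega (d : ℕ) := LatEdge d → ℝ

/-- The lattice edge `{x, y}` determined by a pair of adjacent vertices. -/
def edgeOf {d : ℕ} {x y : Vd d} (h : latAdj x y) : LatEdge d := ⟨s(x, y), x, y, h, rfl⟩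

open Classical in
/-- The weight `ω({x,y})` of the edge between adjacent `x` and `y` (junk value `0` otherwise). -/
noncomputable def wt {d : ℕ} (ω : Omega d) (x y : Vd d) : ℝ :=
  if h : latAdj x y then ω (edgeOf h) else 0

/-- `⟨x,y⟩` is a directed edge of the nearest neighbor graph `N_D`:
`{x,y} ∈ E^d` and `ω({x,y}) ≤ ω({x,z})` for every lattice neighbor `z` of `x`. -/
def nnEdge {d : ℕ} (ω : Omega d) (x y : Vd d) : Prop :=
  latAdj x y ∧ ∀ z : Vd d, latAdj x z → wt ω x y ≤ wt ω x z

/-- The shift of the edge `e` by the lattice vector `z` : `e + z`. -/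
def edgeShift {d : ℕ} (z : Vd d) (e : LatEdge d) : LatEdge d :=
  ⟨Sym2.map (· + z) e.1, by
    obtain ⟨x, y, hxy, he⟩ := e.2
    refine ⟨x + z, y + z, ?_, ?_⟩
    · simpa [latAdj, add_sub_add_right_eq_sub] using hxy
    · rw [he, Sym2.map_pair_eq]⟩

/-- The translation `T_z` on `Ω`: `(T_z ω)(e) = ω (e + z)`. -/
def shiftT {d : ℕ} (z : Vd d) (ω : Omega d) : Omega d := fun e => ω (edgeShift z e)

/-- Assumption A: `P` is a translation invariant probability measure on `Ω`
with a.s. pairwise distinct weights. -/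
def AssumptionA {d : ℕ} (P : Measure (Omega d)) : Prop :=
  IsProbabilityMeasure P ∧
  (∀ z : Vd d, P.map (shiftT z) = P) ∧
  ∀ e f : LatEdge d, e ≠ f → P {ω : Omega d | ω e = ω f} = 0

theorem latAdj_comm {d : ℕ} {x y : Vd d} : latAdj x y ↔ latAdj y x := by
  simp only [latAdj, abs_sub_comm]

theorem latAdj_add_right {d : ℕ} (z : Vd d) {x y : Vd d} :
    latAdj (x + z) (y + z) ↔ latAdj x y := by
  simp [latAdj, add_sub_add_right_eq_sub]

theorem finite_setOf_latAdj {d : ℕ} (x : Vd d) : {y : Vd d | latAdj x y}.Finite := by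
  refine (Set.finite_Icc (x - 1) (x + 1)).subset fun y hy => ?_
  have h : ∀ i, |x i - y i| ≤ 1 := fun i =>
    (Finset.single_le_sum (f := fun i => |x i - y i|) (fun j _ => abs_nonneg _)
      (Finset.mem_univ i)).trans_eq hy
  constructor <;> intro i <;> have := abs_le.1 (h i) <;>
    simp only [Pi.sub_apply, Pi.add_apply, Pi.one_apply] <;> omega

theorem exists_latAdj {d : ℕ} (hd : 1 ≤ d) (x : Vd d) : ∃ y, latAdj x y := by
  refine ⟨x + Pi.single ⟨0, hd⟩ 1, ?_⟩
  simp only [latAdj, Pi.add_apply, sub_add_cancel_left, abs_neg]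
  rw [Finset.sum_eq_single ⟨0, hd⟩] <;> simp +contextual

theorem wt_comm {d : ℕ} (ω : Omega d) (x y : Vd d) : wt ω x y = wt ω y x := by
  by_cases h : latAdj x y
  · rw [wt, wt, dif_pos h, dif_pos (latAdj_comm.1 h)]
    exact congrArg ω (Subtype.ext Sym2.eq_swap)
  · rw [wt, wt, dif_neg h, dif_neg (mt latAdj_comm.1 h)]

theorem wt_shiftT {d : ℕ} (z : Vd d) (ω : Omega d) (x y : Vd d) :
    wt (shiftT z ω) x y = wt ω (x + z) (y + z) := by
  by_cases h : latAdj x y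
  · rw [wt, wt, dif_pos h, dif_pos ((latAdj_add_right z).2 h)]
    rfl
  · rw [wt, wt, dif_neg h, dif_neg (mt (latAdj_add_right z).1 h)]

theorem wt_injective {d : ℕ} {ω : Omega d} (hω : Function.Injective ω) {x y z : Vd d}
    (hy : latAdj x y) (hz : latAdj x z) (h : wt ω x y = wt ω x z) : y = z := by
  rw [wt, wt, dif_pos hy, dif_pos hz] at h
  exact Sym2.congr_right.1 (congrArg Subtype.val (hω h))

theorem measurable_wt {d : ℕ} (x y : Vd d) : Measurable fun ω : Omega d => wt ω x y := by
  by_cases h : latAdj x y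
  · simpa only [wt, dif_pos h] using measurable_pi_apply _
  · simpa only [wt, dif_neg h] using measurable_const

theorem measurable_shiftT {d : ℕ} (z : Vd d) : Measurable (shiftT (d := d) z) :=
  measurable_pi_lambda _ fun _ => measurable_pi_apply _

theorem nnEdge_shiftT {d : ℕ} (z : Vd d) (ω : Omega d) (x y : Vd d) :
    nnEdge (shiftT z ω) x y ↔ nnEdge ω (x + z) (y + z) := by
  simp only [nnEdge, wt_shiftT, latAdj_add_right]
  refine and_congr_right fun _ => ⟨fun h w hw => ?_, fun h w hw => h _ ((latAdj_add_right z).2 hw)⟩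
  have := h (w - z) (by rwa [← latAdj_add_right z, sub_add_cancel])
  rwa [sub_add_cancel] at this

theorem reflTransGen_nnEdge_shiftT {d : ℕ} (z : Vd d) (ω : Omega d) (x y : Vd d) :
    Relation.ReflTransGen (nnEdge (shiftT z ω)) x y ↔
      Relation.ReflTransGen (nnEdge ω) (x + z) (y + z) := by
  constructor
  · exact fun h => h.lift (· + z) fun a b hab => (nnEdge_shiftT z ω a b).1 hab
  · intro h
    have : Relation.ReflTransGen (nnEdge (shiftT z ω)) (x + z - z) (y + z - z) :=
      h.lift (· - z) fun a b hab =>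
      (nnEdge_shiftT z ω _ _).2 (by rwa [sub_add_cancel, sub_add_cancel])
    rwa [add_sub_cancel_right, add_sub_cancel_right] at this

theorem nnEdge_rightUnique {d : ℕ} {ω : Omega d} (hω : Function.Injective ω) :
    Relator.RightUnique (nnEdge ω) := fun _ _ _ hy hz =>
  wt_injective hω hy.1 hz.1 (le_antisymm (hy.2 _ hz.1) (hz.2 _ hy.1))

theorem exists_nnEdge {d : ℕ} (hd : 1 ≤ d) (ω : Omega d) (x : Vd d) : ∃ y, nnEdge ω x y :=
  Set.exists_min_image _ (wt ω x) (finite_setOf_latAdj x) (exists_latAdj hd x)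

theorem wt_le_of_nnEdge {d : ℕ} {ω : Omega d} {x y z : Vd d} (hxy : nnEdge ω x y)
    (hyz : nnEdge ω y z) : wt ω y z ≤ wt ω x y :=
  (hyz.2 x (latAdj_comm.1 hxy.1)).trans_eq (wt_comm ω y x)

theorem wt_lt_of_nnEdge {d : ℕ} {ω : Omega d} (hω : Function.Injective ω) {x y z : Vd d}
    (hxy : nnEdge ω x y) (hyz : nnEdge ω y z) (hne : x ≠ z) : wt ω y z < wt ω x y := by
  refine (wt_le_of_nnEdge hxy hyz).lt_of_ne fun h => hne ?_
  rw [wt_comm ω x y] at h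
  exact (wt_injective hω hyz.1 (latAdj_comm.1 hxy.1) h).symm

/-- Weights do not increase along directed paths. -/
theorem wt_le_of_reflTransGen {d : ℕ} {ω : Omega d} (hω : Function.Injective ω) {x y x' y' : Vd d}
    (h : Relation.ReflTransGen (nnEdge ω) x y) (hx : nnEdge ω x x') (hy : nnEdge ω y y') :
    wt ω y y' ≤ wt ω x x' := by
  induction h generalizing y' with
  | refl => rw [nnEdge_rightUnique hω hx hy]
  | tail _ hbc ih => exact (wt_le_of_nnEdge hbc hy).trans (ih hbc)

/-- The directed path from `y` crosses the level `q` at `u`: the weight of its edge into `u`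
is at least `q`, and the weight of its edge out of `u` is less than `q`. -/
def CrossesAt {d : ℕ} (q : ℝ) (ω : Omega d) (y u : Vd d) : Prop :=
  ∃ v t, Relation.ReflTransGen (nnEdge ω) y v ∧ nnEdge ω v u ∧ nnEdge ω u t ∧
    q ≤ wt ω v u ∧ wt ω u t < q

theorem CrossesAt.unique {d : ℕ} {q : ℝ} {ω : Omega d} (hω : Function.Injective ω)
    {y u u' : Vd d} (h : CrossesAt q ω y u) (h' : CrossesAt q ω y u') : u = u' := by
  obtain ⟨v, t, hyv, hvu, hut, hq, hlt⟩ := h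
  obtain ⟨v', t', hyv', hvu', hut', hq', hlt'⟩ := h'
  have key : ∀ {v u t v' u' : Vd d}, Relation.ReflTransGen (nnEdge ω) v v' → nnEdge ω v u →
      nnEdge ω u t → wt ω u t < q → nnEdge ω v' u' → q ≤ wt ω v' u' → u = u' := by
    intro v u t v' u' hvv' hvu hut hlt hvu' hq'
    rcases hvv'.cases_head with rfl | ⟨w, hvw, hwv'⟩
    · exact nnEdge_rightUnique hω hvu hvu'
    · obtain rfl := nnEdge_rightUnique hω hvu hvw
      exact absurd (wt_le_of_reflTransGen hω hwv' hut hvu') (hlt.trans_le hq').not_ge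
  rcases hyv.total_of_right_unique (nnEdge_rightUnique hω) hyv' with h | h
  · exact key h hvu hut hlt hvu' hq'
  · exact (key h hvu' hut' hlt' hvu hq).symm

theorem crossesAt_shiftT {d : ℕ} (q : ℝ) (z : Vd d) (ω : Omega d) (y u : Vd d) :
    CrossesAt q (shiftT z ω) y u ↔ CrossesAt q ω (y + z) (u + z) := by
  simp only [CrossesAt, reflTransGen_nnEdge_shiftT, nnEdge_shiftT, wt_shiftT]
  exact (Equiv.addRight z).exists_congr fun v => (Equiv.addRight z).exists_congr fun t => Iff.rfl

theorem measurableSet_nnEdge {d : ℕ} (x y : Vd d) :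
    MeasurableSet {ω : Omega d | nnEdge ω x y} :=
  (MeasurableSet.const _).inter <| measurableSet_setOfPred.2 <| Measurable.forall fun _ =>
    Measurable.imp measurable_const (measurableSet_le (measurable_wt _ _) (measurable_wt _ _)).mem

theorem measurableSet_reflTransGen {α β : Type*} [MeasurableSpace α] [Countable β]
    {r : α → β → β → Prop} (hr : ∀ x y, MeasurableSet {a | r a x y}) (x y : β) :
    MeasurableSet {a | Relation.ReflTransGen (r a) x y} := by
  let S : ℕ → β → Set α := fun n => n.rec (fun y => {_a | x = y})
    fun _ T y => ⋃ w, T w ∩ {a | r a w y}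
  have hS : ∀ n y, MeasurableSet (S n y) := by
    intro n
    induction n with
    | zero => exact fun y => MeasurableSet.const _
    | succ n ih => exact fun y => MeasurableSet.iUnion fun w => (ih w).inter (hr w y)
  have : {a | Relation.ReflTransGen (r a) x y} = ⋃ n, S n y := by
    ext a
    simp only [Set.mem_ofPred_eq, Set.mem_iUnion]
    constructor
    · intro h
      induction h with
      | refl => exact ⟨0, rfl⟩
      | @tail b c _ hbc ih =>
        obtain ⟨n, hn⟩ := ih
        exact ⟨n + 1, Set.mem_iUnion.2 ⟨b, hn, hbc⟩⟩
    · rintro ⟨n, hn⟩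
      induction n generalizing y with
      | zero => exact Eq.subst (motive := Relation.ReflTransGen (r a) x) hn .refl
      | succ n ih =>
        obtain ⟨w, hw, hwy⟩ := Set.mem_iUnion.1 hn
        exact (ih w hw).tail hwy
  rw [this]
  exact MeasurableSet.iUnion fun n => hS n y

theorem measurableSet_crossesAt {d : ℕ} (q : ℝ) (y u : Vd d) :
    MeasurableSet {ω : Omega d | CrossesAt q ω y u} := by
  simp only [CrossesAt, Set.ofPred_exists]
  refine MeasurableSet.iUnion fun v => MeasurableSet.iUnion fun t => ?_
  exact (measurableSet_reflTransGen measurableSet_nnEdge y v).inter <|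
    (measurableSet_nnEdge v u).inter <| (measurableSet_nnEdge u t).inter <|
    (measurableSet_le measurable_const (measurable_wt _ _)).inter
    (measurableSet_lt (measurable_wt _ _) measurable_const)

theorem AssumptionA.ae_injective {d : ℕ} {P : Measure (Omega d)} (hP : AssumptionA P) :
    ∀ᵐ ω ∂P, Function.Injective ω := by
  have : ∀ᵐ ω ∂P, ∀ e f : LatEdge d, e ≠ f → ω e ≠ ω f := by
    rw [ae_all_iff]; intro e
    rw [ae_all_iff]; intro f
    by_cases h : e = f
    · simp [h]
    · filter_upwards [measure_eq_zero_iff_ae_notMem.1 (hP.2.2 e f h)] with ω hω _ using hω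
  filter_upwards [this] with ω hω e f h
  exact by_contra fun hne => hω e f hne h

/-- Mass transport: if every vertex is almost surely related to at most one vertex by a
translation covariant random relation, then almost surely only finitely many vertices are
related to a given vertex. -/
theorem AssumptionA.ae_finite_of_unique {d : ℕ} {P : Measure (Omega d)} (hP : AssumptionA P)
    {R : Omega d → Vd d → Vd d → Prop} (hmeas : ∀ x y, MeasurableSet {ω | R ω x y})
    (hshift : ∀ z ω x y, R (shiftT z ω) x y ↔ R ω (x + z) (y + z))
    (huniq : ∀ᵐ ω ∂P, ∀ x y y', R ω x y → R ω x y' → y = y') (u : Vd d) :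
    ∀ᵐ ω ∂P, {y | R ω y u}.Finite := by
  have := hP.1
  have hle : ∑' w, P {ω | R ω 0 w} ≤ 1 := by
    refine (tsum_meas_le_meas_iUnion_of_disjoint₀ P (fun w => (hmeas 0 w).nullMeasurableSet)
      fun w w' hne => ?_).trans prob_le_one
    refine measure_eq_zero_iff_ae_notMem.2 ?_
    filter_upwards [huniq] with ω hω h
    exact hne (hω _ _ _ h.1 h.2)
  have htrans : ∀ y, P {ω | R ω y u} = P {ω | R ω 0 (u - y)} := by
    intro y
    conv_rhs => rw [← hP.2.1 y, Measure.map_apply (measurable_shiftT y) (hmeas _ _)]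
    simp only [Set.preimage_ofPred_eq, hshift, zero_add, sub_add_cancel]
  refine ae_finite_setOfPred_mem (s := fun y => {ω | R ω y u}) ?_
  simp only [htrans]
  exact (((Equiv.subLeft u).tsum_eq fun w => P {ω | R ω 0 w}).trans_le hle).trans_lt
    ENNReal.one_lt_top |>.ne

theorem AssumptionA.ae_finite_crossesAt {d : ℕ} {P : Measure (Omega d)} (hP : AssumptionA P)
    (q : ℝ) (u : Vd d) : ∀ᵐ ω ∂P, {y | CrossesAt q ω y u}.Finite :=
  hP.ae_finite_of_unique (measurableSet_crossesAt q) (crossesAt_shiftT q)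
    (hP.ae_injective.mono fun _ hω _ _ _ h h' => h.unique hω h') u

/-- A path ending at `x` starts at `x` or at its successor `t`, or it enters the path
`x → t` through a vertex outside `{x, t}`. -/
theorem reflTransGen_entry {α : Type*} {r : α → α → Prop} {x y t : α}
    (h : Relation.ReflTransGen r y x) :
    y = x ∨ (y = t ∧ r t x) ∨ (∃ v, r v x ∧ v ≠ t ∧ Relation.ReflTransGen r y v) ∨
      ∃ v, r v t ∧ v ≠ x ∧ r t x ∧ Relation.ReflTransGen r y v := by
  induction h using Relation.ReflTransGen.head_induction_on with
  | refl => exact .inl rfl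
  | @head a c hac _ ih =>
    rcases ih with rfl | ⟨rfl, htx⟩ | ⟨v, hvx, hne, hcv⟩ | ⟨v, hvt, hne, htx, hcv⟩
    · by_cases hat : a = t
      · exact .inr (.inl ⟨hat, hat ▸ hac⟩)
      · exact .inr (.inr (.inl ⟨a, hac, hat, .refl⟩))
    · by_cases hax : a = x
      · exact .inl hax
      · exact .inr (.inr (.inr ⟨a, hac, hax, htx, .refl⟩))
    · exact .inr (.inr (.inl ⟨v, hvx, hne, hcv.head hac⟩))
    · exact .inr (.inr (.inr ⟨v, hvt, hne, htx, hcv.head hac⟩))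

/-- A vertex with infinitely many ancestors yields an edge `v → u` along which the weight drops
strictly and whose tail has infinitely many ancestors. -/
theorem exists_wt_lt_of_infinite {d : ℕ} (hd : 1 ≤ d) {ω : Omega d}
    (hω : Function.Injective ω) {x : Vd d}
    (hx : {y | Relation.ReflTransGen (nnEdge ω) y x}.Infinite) :
    ∃ v u t, nnEdge ω v u ∧ nnEdge ω u t ∧ wt ω u t < wt ω v u ∧
      {y | Relation.ReflTransGen (nnEdge ω) y v}.Infinite := by
  obtain ⟨t, hxt⟩ := exists_nnEdge hd ω x
  by_contra! H
  have hfin : ∀ u w, nnEdge ω u w →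
      (⋃ v ∈ {v | nnEdge ω v u ∧ v ≠ w},
        {y | Relation.ReflTransGen (nnEdge ω) y v}).Finite := by
    intro u w huw
    refine Set.Finite.biUnion ((finite_setOf_latAdj u).subset fun v hv => latAdj_comm.1 hv.1.1) ?_
    exact fun v hv => Set.not_infinite.1 fun hinf =>
      hinf (H v u w hv.1 huw (wt_lt_of_nnEdge hω hv.1 huw hv.2))
  have hfin' : (⋃ v ∈ {v | nnEdge ω v t ∧ v ≠ x ∧ nnEdge ω t x},
      {y | Relation.ReflTransGen (nnEdge ω) y v}).Finite := by
    by_cases htx : nnEdge ω t x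
    · simpa [htx] using hfin t x htx
    · simp [htx]
  refine hx (((Set.toFinite {x, t}).union ((hfin x t hxt).union hfin')).subset fun y hy => ?_)
  rcases reflTransGen_entry (t := t) hy with h | h | ⟨v, h₁, h₂, h₃⟩ | ⟨v, h₁, h₂, h₃, h₄⟩
  · exact .inl (.inl h)
  · exact .inl (.inr h.1)
  · exact .inr (.inl (Set.mem_biUnion (x := v) ⟨h₁, h₂⟩ h₃))
  · exact .inr (.inr (Set.mem_biUnion (x := v) ⟨h₁, h₂, h₃⟩ h₄))

/-- **Theorem (no infinite backward paths).** Under assumption A, almost surely, for every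
`x ∈ ℤ^d` the set of vertices `y` with a directed path from `y` to `x` in `N_D`
(the vertex set of `C_x`) is finite. -/
theorem no_infinite_backward_paths (d : ℕ) (hd : 1 ≤ d)
    (P : Measure (Omega d)) (hP : AssumptionA P) :
    ∀ᵐ ω ∂P, ∀ x : Vd d,
      {y : Vd d | Relation.ReflTransGen (nnEdge ω) y x}.Finite := by
  have hcross : ∀ᵐ ω ∂P, ∀ (q : ℚ) (u : Vd d), {y | CrossesAt q ω y u}.Finite :=
    ae_all_iff.2 fun q => ae_all_iff.2 fun u => hP.ae_finite_crossesAt q u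
  filter_upwards [hP.ae_injective, hcross] with ω hω hfin x
  by_contra hx
  obtain ⟨v, u, t, hvu, hut, hlt, hinf⟩ := exists_wt_lt_of_infinite hd hω hx
  obtain ⟨q, hq, hq'⟩ := exists_rat_btwn hlt
  exact hinf ((hfin q u).subset fun y hy => ⟨v, t, hy, hvu, hut, hq'.le, hq⟩)
end

section
/- Let G = (V, E) be a graph (no self-loops, no multiple edges) with countable edge set E, and let 𝔾 = (V, 𝔼) be a directed graph on the same vertex set such that: (1) if ⟨x,y⟩ ∈ 𝔼 then {x,y} ∈ E; (2) every x ∈ V has out-degree exactly one in 𝔾; (3) 𝔾 has no directed cycles of length at least three; and (4) for every x ∈ V, the set of vertices y with a directed path from y to x in 𝔾 is finite. Then there exists an injective weight function ω : E → ℝ such that the directed nearest neighbor graph N_D of (G, ω) equals 𝔾. -/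
/-- A directed path in the graph of a function reaches an iterate of its starting point. -/
theorem exists_iterate_eq_of_reflTransGen {V : Type*} {Dir : V → V → Prop} {f : V → V}
    (hf : ∀ a b, Dir a b → b = f a) {x z : V} (hxz : Relation.ReflTransGen Dir x z) :
    ∃ n : ℕ, f^[n] x = z := by
  induction hxz with
  | refl => exact ⟨0, rfl⟩
  | tail _ hbc ih =>
    obtain ⟨n, hn⟩ := ih
    exact ⟨n + 1, by rw [Function.iterate_succ_apply', hn, hf _ _ hbc]⟩

/-- In a functional digraph without loops and without directed cycles of length at least three,
an edge `⟨z, x⟩` closing a directed path from `x` to `z` belongs to a cycle of length two. -/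
theorem dir_of_reflTransGen_of_no_long_cycle {V : Type*} {Dir : V → V → Prop}
    (hirr : ∀ x, ¬ Dir x x) (huniq : ∀ x : V, ∃! y, Dir x y)
    (hcyc : ¬ ∃ (k : ℕ) (c : ℕ → V), 3 ≤ k ∧
        (∀ i < k, Dir (c i) (c (i + 1))) ∧
        (∀ i j, i < j → j < k → c i ≠ c j) ∧ c k = c 0)
    {x z : V} (hxz : Relation.ReflTransGen Dir x z) (hzx : Dir z x) : Dir x z := by
  choose f hf hfu using huniq
  replace hfu : ∀ a b, Dir a b → b = f a := hfu
  obtain ⟨n, hn⟩ := exists_iterate_eq_of_reflTransGen hfu hxz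
  have hper : Function.IsPeriodicPt f (n + 1) x := by
    rw [Function.IsPeriodicPt, Function.IsFixedPt, Function.iterate_succ_apply', hn]
    exact (hfu _ _ hzx).symm
  have hpos : 0 < Function.minimalPeriod f x := hper.minimalPeriod_pos n.succ_pos
  have hmin : f^[Function.minimalPeriod f x] x = x := Function.iterate_minimalPeriod
  have hlt : Function.minimalPeriod f x < 3 := by
    by_contra! hge
    refine hcyc ⟨Function.minimalPeriod f x, fun i => f^[i] x, hge, fun i _ => ?_,
      fun i j hij hj heq => hij.ne ?_, hmin⟩
    · simp only [Function.iterate_succ_apply']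
      exact hf _
    · exact Function.iterate_injOn_Iio_minimalPeriod (hij.trans hj) hj heq
  have hdvd : Function.minimalPeriod f x ∣ n + 1 := hper.minimalPeriod_dvd
  interval_cases hp : Function.minimalPeriod f x
  · have hfx := hf x
    rw [show f x = x from hmin] at hfx
    exact absurd hfx (hirr x)
  · obtain ⟨m, hm⟩ := hdvd
    have hfz : f x = z := by
      rw [← hn, ← Function.iterate_mod_minimalPeriod_eq, hp, show n % 2 = 1 by omega]
      rfl
    exact hfz ▸ hf x

/-- The vertices from which a directed path of `Dir` leads to the tail of an orientation of `e`
belonging to `Dir`. -/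
def edgeAncestors {V : Type*} (Dir : V → V → Prop) (e : Sym2 V) : Set V :=
  {u | ∃ a b, e = s(a, b) ∧ Dir a b ∧ Relation.ReflTransGen Dir u a}

theorem edgeAncestors_finite {V : Type*} {Dir : V → V → Prop}
    (hfin : ∀ x : V, {y : V | Relation.ReflTransGen Dir y x}.Finite) (e : Sym2 V) :
    (edgeAncestors Dir e).Finite := by
  induction e using Sym2.ind with
  | _ x y =>
    refine ((hfin x).union (hfin y)).subset ?_
    rintro u ⟨a, b, hab, -, hu⟩
    rcases Sym2.eq_iff.mp hab with ⟨rfl, -⟩ | ⟨-, rfl⟩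
    · exact Or.inl hu
    · exact Or.inr hu

theorem ncard_edgeAncestors_lt {V : Type*} {Dir : V → V → Prop}
    (hirr : ∀ x, ¬ Dir x x) (huniq : ∀ x : V, ∃! y, Dir x y)
    (hcyc : ¬ ∃ (k : ℕ) (c : ℕ → V), 3 ≤ k ∧
        (∀ i < k, Dir (c i) (c (i + 1))) ∧
        (∀ i j, i < j → j < k → c i ≠ c j) ∧ c k = c 0)
    (hfin : ∀ x : V, {y : V | Relation.ReflTransGen Dir y x}.Finite)
    {x y z : V} (hxy : Dir x y) (hzy : z ≠ y) :
    (edgeAncestors Dir s(x, z)).ncard < (edgeAncestors Dir s(x, y)).ncard := by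
  have hxz : ¬ Dir x z := fun h => hzy ((huniq x).unique h hxy)
  have hmem : ∀ u ∈ edgeAncestors Dir s(x, z), Dir z x ∧ Relation.ReflTransGen Dir u z := by
    rintro u ⟨a, b, hab, hdir, hu⟩
    rcases Sym2.eq_iff.mp hab with ⟨rfl, rfl⟩ | ⟨rfl, rfl⟩
    · exact absurd hdir hxz
    · exact ⟨hdir, hu⟩
  refine Set.ncard_lt_ncard (Set.ssubset_iff_of_subset ?_ |>.mpr ?_)
    (edgeAncestors_finite hfin _)
  · intro u hu
    exact ⟨x, y, rfl, hxy, (hmem u hu).2.tail (hmem u hu).1⟩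
  · refine ⟨x, ⟨x, y, rfl, hxy, .refl⟩, fun hx => hxz ?_⟩
    exact dir_of_reflTransGen_of_no_long_cycle hirr huniq hcyc (hmem x hx).2 (hmem x hx).1

/-- A function to `ℕ` on a countable type can be perturbed to an injective real function that
reverses strict inequalities. -/
theorem exists_injective_strict_anti {E : Type*} [Countable E] (r : E → ℕ) :
    ∃ ω : E → ℝ, Function.Injective ω ∧ ∀ e e', r e < r e' → ω e' < ω e := by
  obtain ⟨g, hg⟩ := exists_injective_nat E
  have hpos : ∀ e, 0 < 1 / ((g e : ℝ) + 2) := fun e => by positivity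
  have hlt : ∀ e, 1 / ((g e : ℝ) + 2) < 1 := fun e => by
    rw [div_lt_one (by positivity)]
    have : (0 : ℝ) ≤ g e := Nat.cast_nonneg _
    linarith
  have hanti : ∀ e e', r e < r e' →
      1 / ((g e' : ℝ) + 2) - r e' < 1 / ((g e : ℝ) + 2) - r e := fun e e' h => by
    have : (r e : ℝ) + 1 ≤ r e' := by exact_mod_cast h
    linarith [hpos e, hlt e']
  refine ⟨fun e => 1 / ((g e : ℝ) + 2) - r e, fun e e' h => ?_, hanti⟩
  rcases lt_trichotomy (r e) (r e') with hr | hr | hr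
  · exact absurd h (hanti e e' hr).ne'
  · simp only [hr, sub_left_inj, one_div, inv_inj, add_left_inj, Nat.cast_inj] at h
    exact hg h
  · exact absurd h (hanti e' e hr).ne

/-- **Theorem (realization as a nearest neighbor graph).** Let `G` be a graph (no
self-loops, no multiple edges) with countable edge set, and let `Dir` be a directed graph
on the same vertex set such that: (1) every directed edge is an edge of `G`; (2) every
vertex has out-degree exactly one; (3) there are no directed cycles of length at least
three; (4) for every vertex `x`, the set of vertices `y` with a directed path `y → x` is
finite.  Then there is an injective weight function `ω : E → ℝ` whose directed nearest
neighbor graph is exactly `Dir`. -/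
theorem realizable_as_nearest_neighbor_graph {V : Type*} (G : SimpleGraph V)
    (hE : G.edgeSet.Countable) (Dir : V → V → Prop)
    (h1 : ∀ x y, Dir x y → G.Adj x y)
    (h2 : ∀ x : V, ∃! y, Dir x y)
    (h3 : ¬ ∃ (k : ℕ) (c : ℕ → V), 3 ≤ k ∧
        (∀ i < k, Dir (c i) (c (i + 1))) ∧
        (∀ i j, i < j → j < k → c i ≠ c j) ∧ c k = c 0)
    (h4 : ∀ x : V, {y : V | Relation.ReflTransGen Dir y x}.Finite) :
    ∃ ω : G.edgeSet → ℝ, Function.Injective ω ∧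
      ∀ x y : V, Dir x y ↔
        ∃ hxy : G.Adj x y, ∀ (z : V) (hz : G.Adj x z),
          ω ⟨s(x, y), G.mem_edgeSet.mpr hxy⟩ ≤ ω ⟨s(x, z), G.mem_edgeSet.mpr hz⟩ := by
  have hirr : ∀ x, ¬ Dir x x := fun x h => G.irrefl (h1 x x h)
  have : Countable G.edgeSet := hE.to_subtype
  obtain ⟨ω, hinj, hω⟩ :=
    exists_injective_strict_anti fun e : G.edgeSet => (edgeAncestors Dir e.1).ncard
  have hlt : ∀ x y z (hxy : Dir x y) (hz : G.Adj x z), z ≠ y →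
      ω ⟨s(x, y), G.mem_edgeSet.mpr (h1 x y hxy)⟩ < ω ⟨s(x, z), G.mem_edgeSet.mpr hz⟩ :=
    fun x y z hxy hz hzy => hω _ _ (ncard_edgeAncestors_lt hirr h2 h3 h4 hxy hzy)
  refine ⟨ω, hinj, fun x y => ⟨fun hxy => ⟨h1 x y hxy, fun z hz => ?_⟩, ?_⟩⟩
  · rcases eq_or_ne z y with rfl | hzy
    · exact le_rfl
    · exact (hlt x y z hxy hz hzy).le
  · rintro ⟨hxy, hle⟩
    obtain ⟨w, hw, -⟩ := h2 x
    rcases eq_or_ne y w with rfl | hyw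
    · exact hw
    · exact absurd (hle w (h1 x w hw)) (hlt x w y hw hxy hyw).not_ge
end

section
/- Let V ⊆ ℤ². If x ∈ V̄ has a site-neighbor in the complement of V̄, then x ∈ V. -/
/-- `x` and `y` are site-neighbors in `ℤ²`: `‖x − y‖₁ = 1`. -/
def siteAdj (x y : ℤ × ℤ) : Prop := |x.1 - y.1| + |x.2 - y.2| = 1

/-- `x` and `y` are joined by a path of site-neighbors remaining in `W`. -/
def connIn (W : Set (ℤ × ℤ)) (x y : ℤ × ℤ) : Prop :=
  Relation.ReflTransGen (fun a b => siteAdj a b ∧ a ∈ W ∧ b ∈ W) x y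

/-- The site-component of `W` containing `x` (for `x ∈ W`). -/
def siteComp (W : Set (ℤ × ℤ)) (x : ℤ × ℤ) : Set (ℤ × ℤ) := {y | connIn W x y}

/-- The closure `V̄` of `V`: the union of `V` with all finite site-components of `Vᶜ`. -/
def clo (V : Set (ℤ × ℤ)) : Set (ℤ × ℤ) :=
  V ∪ {x | x ∉ V ∧ (siteComp Vᶜ x).Finite}

/-- **Lemma.** If `x ∈ V̄` has a site-neighbor outside `V̄`, then `x ∈ V`. -/
theorem mem_of_neighbor_outside_closure (V : Set (ℤ × ℤ)) (x : ℤ × ℤ)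
    (hx : x ∈ clo V) (y : ℤ × ℤ) (hadj : siteAdj x y) (hy : y ∉ clo V) :
    x ∈ V := by
  by_contra hxV
  rcases hx with hx | ⟨-, hfin⟩
  · exact hxV hx
  · have hyV : y ∉ V := fun h => hy (Or.inl h)
    exact hy (Or.inr ⟨hyV, hfin.subset fun _ hz =>
      Relation.ReflTransGen.head ⟨hadj, hxV, hyV⟩ hz⟩)
end

section
/- Let V ⊆ ℤ² be site-connected. Then every vertex of the dual edge boundary graph B(V) (i.e., every dual vertex incident to at least one edge of B(V)) has degree exactly two in B(V). -/
/-- `a` and `b` (dual vertices, where `w` stands for the point `w + (1/2, 1/2)`) are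
joined by an edge of the dual edge boundary `B(V)`: they are dual neighbors and the
unique primal edge `{x, y}` bisected by the dual edge `{a, b}` (characterized by
`siteAdj x y` and `x + y = a + b + (1,1)`) has `x ∈ V̄` and `y ∉ V̄`. -/
def dualBdryAdj (V : Set (ℤ × ℤ)) (a b : ℤ × ℤ) : Prop :=
  siteAdj a b ∧ ∃ x y : ℤ × ℤ, siteAdj x y ∧ x + y = a + b + (1, 1) ∧
    x ∈ clo V ∧ y ∉ clo V

theorem siteAdj_iff {a b c d : ℤ} : siteAdj (a, b) (c, d) ↔
    (c = a + 1 ∧ d = b) ∨ (a = c + 1 ∧ d = b) ∨ (c = a ∧ d = b + 1) ∨ (c = a ∧ b = d + 1) := by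
  simp only [siteAdj]
  rcases abs_cases (a - c) with h | h <;> rcases abs_cases (b - d) with h' | h' <;> omega

/-- For a path in `V` from `p` to `r` there is a signed count `N z` of its traversals of the
horizontal edges below `z` between the columns `z.1` and `z.1 + 1`. It is constant along vertical
edges off the path, satisfies flow conservation on vertical half-columns, and is explicit far
away. -/
theorem exists_crossing_count {V : Set (ℤ × ℤ)} {p r : ℤ × ℤ} (h : connIn V p r) :
    ∃ (N : ℤ → ℤ → ℤ) (R : ℤ),
      (∀ a b, (a, b) ∉ V ∨ (a + 1, b) ∉ V → N a (b + 1) = N a b) ∧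
      (∀ a b, (a + 1, b) ∉ V → N a b - N (a + 1) b =
        (if r.1 = a + 1 ∧ r.2 < b then 1 else 0) - (if p.1 = a + 1 ∧ p.2 < b then 1 else 0)) ∧
      (∀ a b, R < a ∨ a < -R ∨ b < -R → N a b = 0) ∧
      (∀ a b, R < b →
        N a b = (if a < r.1 then 1 else 0) - (if a < p.1 then 1 else 0)) := by
  induction h with
  | refl => exact ⟨fun _ _ => 0, 0, by simp⟩
  | @tail u v _ huv ih =>
    obtain ⟨N, R, h1, h2, h3, h4⟩ := ih
    obtain ⟨hadj, hu, hv⟩ := huv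
    obtain ⟨u1, u2⟩ := u
    obtain ⟨v1, v2⟩ := v
    have hcase := siteAdj_iff.1 hadj
    have hu1 := le_abs_self u1
    have hu1' := neg_abs_le u1
    have hu2 := le_abs_self u2
    have hu2' := neg_abs_le u2
    refine ⟨fun a b => N a b + (if u1 = a ∧ v1 = a + 1 ∧ u2 < b then 1 else 0)
      - (if v1 = a ∧ u1 = a + 1 ∧ u2 < b then 1 else 0),
      max R (max (|u1| + 1) (|u2| + 1)), ?_, ?_, ?_, ?_⟩
    · intro a b hab
      have hne : ¬ ((u1 = a ∧ v1 = a + 1 ∨ v1 = a ∧ u1 = a + 1) ∧ u2 = b) := by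
        rintro ⟨h, rfl⟩
        have hv2 : v2 = u2 := by omega
        subst hv2
        rcases h with ⟨rfl, rfl⟩ | ⟨rfl, rfl⟩ <;> tauto
      have := h1 a b hab
      dsimp only
      split_ifs <;> omega
    · intro a b hab
      have hune : ¬ (u1 = a + 1 ∧ u2 = b) := by rintro ⟨rfl, rfl⟩; exact hab hu
      have hvne : ¬ (v1 = a + 1 ∧ v2 = b) := by rintro ⟨rfl, rfl⟩; exact hab hv
      have := h2 a b hab
      dsimp only at this ⊢
      clear h1 h2 h3 h4
      rcases hcase with ⟨rfl, rfl⟩ | ⟨rfl, rfl⟩ | ⟨rfl, rfl⟩ | ⟨rfl, rfl⟩ <;>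
        split_ifs at this ⊢ <;> omega
    · intro a b hab
      have := h3 a b (by omega)
      dsimp only
      split_ifs <;> omega
    · intro a b hab
      have := h4 a b (by omega)
      dsimp only at this ⊢
      clear h1 h2 h3 h4
      rcases hcase with ⟨rfl, rfl⟩ | ⟨rfl, rfl⟩ | ⟨rfl, rfl⟩ | ⟨rfl, rfl⟩ <;>
        split_ifs at this ⊢ <;> omega

/-- A function on `ℤ²` that is preserved by the steps of `W` and vanishes outside a box vanishes
at every vertex with infinite site-component in `W`. -/
theorem eq_zero_of_infinite_siteComp {W : Set (ℤ × ℤ)} {M : ℤ → ℤ → ℤ} {R : ℤ}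
    (hv : ∀ a b, (a, b) ∈ W → (a, b + 1) ∈ W → M a (b + 1) = M a b)
    (hh : ∀ a b, (a, b) ∈ W → (a + 1, b) ∈ W → M (a + 1) b = M a b)
    (hR : ∀ a b, R < a ∨ a < -R ∨ b < -R ∨ R < b → M a b = 0)
    {q : ℤ × ℤ} (hq : (siteComp W q).Infinite) : M q.1 q.2 = 0 := by
  have hinv : ∀ z, connIn W q z → M z.1 z.2 = M q.1 q.2 := by
    intro z hz
    induction hz with
    | refl => rfl
    | @tail u v _ huv ih =>
      obtain ⟨hadj, hu, hw⟩ := huv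
      obtain ⟨u1, u2⟩ := u
      obtain ⟨v1, v2⟩ := v
      rw [← ih]
      rcases siteAdj_iff.1 hadj with ⟨rfl, rfl⟩ | ⟨rfl, rfl⟩ | ⟨rfl, rfl⟩ | ⟨rfl, rfl⟩
      · exact hh _ _ hu hw
      · exact (hh _ _ hw hu).symm
      · exact hv _ _ hu hw
      · exact (hv _ _ hw hu).symm
  obtain ⟨z, hz, hzR⟩ := hq.exists_notMem_finite
    ((Set.finite_Icc (-R) R).prod (Set.finite_Icc (-R) R))
  rw [← hinv z hz]
  apply hR
  simp only [Set.mem_prod, Set.mem_Icc] at hzR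
  omega

/-- If two diagonal corners `(c, e)` and `(c + 1, f)` of a unit square are joined by a path in `V`,
the other two corners cannot both have infinite site-components in `Vᶜ`. -/
theorem not_infinite_of_diagonal_connIn {V : Set (ℤ × ℤ)} {c e f : ℤ}
    (hef : f = e + 1 ∨ e = f + 1) (hp : (c, e) ∈ V) (hr : (c + 1, f) ∈ V)
    (h : connIn V (c, e) (c + 1, f)) (hq : (c, f) ∉ V) (hs : (c + 1, e) ∉ V)
    (hqi : (siteComp Vᶜ (c, f)).Infinite) (hsi : (siteComp Vᶜ (c + 1, e)).Infinite) : False := by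
  obtain ⟨N, R, h1, h2, h3, h4⟩ := exists_crossing_count h
  dsimp only at h2 h4
  set M : ℤ → ℤ → ℤ := fun a b => N a b - (if a = c ∧ e ≤ b ∧ f ≤ b then 1 else 0) with hM
  have hv : ∀ a b, (a, b) ∈ Vᶜ → (a, b + 1) ∈ Vᶜ → M a (b + 1) = M a b := by
    intro a b ha hb
    have hne : ¬ (a = c ∧ b = e) := by rintro ⟨rfl, rfl⟩; exact ha hp
    have hne' : ¬ (a = c ∧ b + 1 = e) := by rintro ⟨rfl, rfl⟩; exact hb hp
    have := h1 a b (Or.inl ha)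
    simp only [hM]
    split_ifs <;> omega
  have hh : ∀ a b, (a, b) ∈ Vᶜ → (a + 1, b) ∈ Vᶜ → M (a + 1) b = M a b := by
    intro a b ha hb
    have hne : ¬ (a = c ∧ b = e) := by rintro ⟨rfl, rfl⟩; exact ha hp
    have hne1 : ¬ (a + 1 = c ∧ b = e) := by rintro ⟨rfl, rfl⟩; exact hb hp
    have hne2 : ¬ (a = c + 1 ∧ b = f) := by rintro ⟨rfl, rfl⟩; exact ha hr
    have hne3 : ¬ (a = c ∧ b = f) := by rintro ⟨rfl, rfl⟩; exact hb hr
    have := h2 a b hb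
    simp only [hM]
    split_ifs at this ⊢ <;> omega
  have hR : ∀ a b, max R (|c| + |e| + |f| + 1) < a ∨ a < -max R (|c| + |e| + |f| + 1) ∨
      b < -max R (|c| + |e| + |f| + 1) ∨ max R (|c| + |e| + |f| + 1) < b → M a b = 0 := by
    intro a b hab
    have hc := le_abs_self c
    have hc' := neg_abs_le c
    have he := le_abs_self e
    have he' := neg_abs_le e
    have hf := le_abs_self f
    have hf' := neg_abs_le f
    simp only [hM]
    by_cases hb : R < b ∧ e ≤ b ∧ f ≤ b
    · have := h4 a b hb.1
      split_ifs at this ⊢ <;> omega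
    · have := h3 a b (by omega)
      split_ifs <;> omega
  have hMq := eq_zero_of_infinite_siteComp hv hh hR hqi
  have hMs := eq_zero_of_infinite_siteComp hv hh hR hsi
  simp only [hM] at hMq hMs
  have hflow := h2 c e hs
  rcases hef with rfl | rfl
  · have := h1 c e (Or.inr hs)
    simp at hMq hMs hflow
    omega
  · have := h1 c f (Or.inl hq)
    simp at hMq hMs hflow
    omega

theorem siteAdj_comm {x y : ℤ × ℤ} : siteAdj x y ↔ siteAdj y x := by
  simp only [siteAdj, abs_sub_comm]

theorem notMem_and_infinite_of_notMem_clo {V : Set (ℤ × ℤ)} {x : ℤ × ℤ} (hx : x ∉ clo V) :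
    x ∉ V ∧ (siteComp Vᶜ x).Infinite := by
  simp only [clo, Set.mem_union, Set.mem_ofPred_eq] at hx
  exact ⟨fun h => hx (Or.inl h), fun h => hx (Or.inr ⟨fun h' => hx (Or.inl h'), h⟩)⟩

/-- A vertex of the closure with a site-neighbor outside the closure lies in the set itself. -/
theorem mem_of_mem_clo_of_siteAdj {V : Set (ℤ × ℤ)} {x y : ℤ × ℤ} (hxy : siteAdj x y)
    (hx : x ∈ clo V) (hy : y ∉ clo V) : x ∈ V := by
  obtain hx | ⟨hxV, hfin⟩ := hx
  · exact hx
  · obtain ⟨hyV, hinf⟩ := notMem_and_infinite_of_notMem_clo hy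
    refine absurd (hfin.subset ?_) hinf
    exact fun z hz => Relation.ReflTransGen.head ⟨hxy, hxV, hyV⟩ hz

/-- The closure of a site-connected set contains no unit square in a checkerboard pattern. -/
theorem clo_no_checkerboard {V : Set (ℤ × ℤ)} (hconn : ∀ x ∈ V, ∀ y ∈ V, connIn V x y)
    {c e f : ℤ} (hef : f = e + 1 ∨ e = f + 1) (hp : (c, e) ∈ clo V) (hr : (c + 1, f) ∈ clo V)
    (hq : (c, f) ∉ clo V) (hs : (c + 1, e) ∉ clo V) : False := by
  have hpV : (c, e) ∈ V := mem_of_mem_clo_of_siteAdj (by simp [siteAdj]) hp hs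
  have hrV : (c + 1, f) ∈ V := mem_of_mem_clo_of_siteAdj (by simp [siteAdj]) hr hq
  obtain ⟨hqV, hqi⟩ := notMem_and_infinite_of_notMem_clo hq
  obtain ⟨hsV, hsi⟩ := notMem_and_infinite_of_notMem_clo hs
  exact not_infinite_of_diagonal_connIn hef hpV hrV (hconn _ hpV _ hrV) hqV hsV hqi hsi

/-- The dual edge `{a, b}` lies in `B(V)` iff exactly one endpoint of the bisecting edge `{x, y}`
lies in the closure. -/
theorem dualBdryAdj_iff {V : Set (ℤ × ℤ)} {a b x y : ℤ × ℤ} (hab : siteAdj a b)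
    (hxy : siteAdj x y) (hsum : x + y = a + b + (1, 1)) :
    dualBdryAdj V a b ↔ (x ∈ clo V ↔ y ∉ clo V) := by
  constructor
  · rintro ⟨-, x', y', hxy', hsum', hx', hy'⟩
    have hcase : (x' = x ∧ y' = y) ∨ (x' = y ∧ y' = x) := by
      obtain ⟨x1, x2⟩ := x
      obtain ⟨y1, y2⟩ := y
      obtain ⟨x1', x2'⟩ := x'
      obtain ⟨y1', y2'⟩ := y'
      rw [← hsum] at hsum'
      simp only [siteAdj_iff, Prod.mk_add_mk, Prod.mk.injEq] at *
      omega
    rcases hcase with ⟨rfl, rfl⟩ | ⟨rfl, rfl⟩ <;> simp [hx', hy']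
  · intro h
    by_cases hx : x ∈ clo V
    · exact ⟨hab, x, y, hxy, hsum, hx, h.1 hx⟩
    · exact ⟨hab, y, x, siteAdj_comm.1 hxy, by rw [add_comm, hsum], not_not.1 fun hy => hx (h.2 hy), hx⟩

/-- Around a unit square with corners `A`, `B`, `C`, `D` that is neither constant nor a
checkerboard, the value changes along exactly two of the four sides. -/
theorem two_of_four_changes {A B C D r l u d : Prop} (hr : r ↔ (B ↔ ¬ C)) (hu : u ↔ (D ↔ ¬ C))
    (hl : l ↔ (A ↔ ¬ D)) (hd : d ↔ (A ↔ ¬ B)) (hsome : r ∨ l ∨ u ∨ d)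
    (hdiag : A → C → ¬ D → ¬ B → False) (hanti : D → B → ¬ A → ¬ C → False) :
    (r ∧ l ∧ ¬ u ∧ ¬ d) ∨ (r ∧ u ∧ ¬ l ∧ ¬ d) ∨ (r ∧ d ∧ ¬ l ∧ ¬ u) ∨
      (l ∧ u ∧ ¬ r ∧ ¬ d) ∨ (l ∧ d ∧ ¬ r ∧ ¬ u) ∨ (u ∧ d ∧ ¬ r ∧ ¬ l) := by
  rw [hr, hu, hl, hd] at *
  clear hr hu hl hd
  by_cases A <;> by_cases B <;> by_cases C <;> by_cases D <;> simp_all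

/-- **Lemma.** If `V ⊆ ℤ²` is site-connected, then every dual vertex incident to at least
one edge of the dual edge boundary `B(V)` has degree exactly two in `B(V)`. -/
theorem dual_boundary_degree_two (V : Set (ℤ × ℤ))
    (hconn : ∀ x ∈ V, ∀ y ∈ V, connIn V x y)
    (a : ℤ × ℤ) (ha : ∃ b, dualBdryAdj V a b) :
    {b : ℤ × ℤ | dualBdryAdj V a b}.encard = 2 := by
  obtain ⟨c, d⟩ := a
  have hright := dualBdryAdj_iff (V := V) (a := (c, d)) (b := (c + 1, d)) (x := (c + 1, d))
    (y := (c + 1, d + 1)) (by simp [siteAdj]) (by simp [siteAdj]) (by ext <;> simp <;> ring)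
  have hleft := dualBdryAdj_iff (V := V) (a := (c, d)) (b := (c - 1, d)) (x := (c, d))
    (y := (c, d + 1)) (by simp [siteAdj]) (by simp [siteAdj]) (by ext <;> simp <;> ring)
  have hup := dualBdryAdj_iff (V := V) (a := (c, d)) (b := (c, d + 1)) (x := (c, d + 1))
    (y := (c + 1, d + 1)) (by simp [siteAdj]) (by simp [siteAdj]) (by ext <;> simp <;> ring)
  have hdown := dualBdryAdj_iff (V := V) (a := (c, d)) (b := (c, d - 1)) (x := (c, d))
    (y := (c + 1, d)) (by simp [siteAdj]) (by simp [siteAdj]) (by ext <;> simp <;> ring)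
  have hnbr : ∀ b, dualBdryAdj V (c, d) b →
      b = (c + 1, d) ∨ b = (c - 1, d) ∨ b = (c, d + 1) ∨ b = (c, d - 1) := by
    rintro ⟨b1, b2⟩ ⟨hb, -⟩
    simp only [siteAdj_iff, Prod.mk.injEq] at *
    omega
  have hdiag := clo_no_checkerboard hconn (c := c) (e := d) (f := d + 1) (Or.inl rfl)
  have hanti := clo_no_checkerboard hconn (c := c) (e := d + 1) (f := d) (Or.inr rfl)
  have hpair : ∃ x y : ℤ × ℤ, x ≠ y ∧ dualBdryAdj V (c, d) x ∧ dualBdryAdj V (c, d) y ∧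
      ∀ b, dualBdryAdj V (c, d) b → b = x ∨ b = y := by
    have key : ∀ x y z w : ℤ × ℤ, x ≠ y → dualBdryAdj V (c, d) x → dualBdryAdj V (c, d) y →
        ¬ dualBdryAdj V (c, d) z → ¬ dualBdryAdj V (c, d) w →
        (∀ b, dualBdryAdj V (c, d) b → b = x ∨ b = y ∨ b = z ∨ b = w) →
        ∃ x y : ℤ × ℤ, x ≠ y ∧ dualBdryAdj V (c, d) x ∧ dualBdryAdj V (c, d) y ∧
          ∀ b, dualBdryAdj V (c, d) b → b = x ∨ b = y := by
      intro x y z w hne hx hy hz hw hall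
      refine ⟨x, y, hne, hx, hy, fun b hb => ?_⟩
      rcases hall b hb with h | h | rfl | rfl
      exacts [Or.inl h, Or.inr h, absurd hb hz, absurd hb hw]
    have hsome : dualBdryAdj V (c, d) (c + 1, d) ∨ dualBdryAdj V (c, d) (c - 1, d) ∨
        dualBdryAdj V (c, d) (c, d + 1) ∨ dualBdryAdj V (c, d) (c, d - 1) := by
      obtain ⟨b, hb⟩ := ha
      rcases hnbr b hb with rfl | rfl | rfl | rfl <;> simp only [hb, true_or, or_true]
    rcases two_of_four_changes hright hup hleft hdown hsome hdiag hanti with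
      ⟨hr, hl, hu, hd⟩ | ⟨hr, hu, hl, hd⟩ | ⟨hr, hd, hl, hu⟩ |
      ⟨hl, hu, hr, hd⟩ | ⟨hl, hd, hr, hu⟩ | ⟨hu, hd, hr, hl⟩
    · exact key _ _ _ _ (by simp; omega) hr hl hu hd fun b hb => by
        rcases hnbr b hb with h | h | h | h <;> simp [h]
    · exact key _ _ _ _ (by simp) hr hu hl hd fun b hb => by
        rcases hnbr b hb with h | h | h | h <;> simp [h]
    · exact key _ _ _ _ (by simp) hr hd hl hu fun b hb => by
        rcases hnbr b hb with h | h | h | h <;> simp [h]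
    · exact key _ _ _ _ (by simp) hl hu hr hd fun b hb => by
        rcases hnbr b hb with h | h | h | h <;> simp [h]
    · exact key _ _ _ _ (by simp) hl hd hr hu fun b hb => by
        rcases hnbr b hb with h | h | h | h <;> simp [h]
    · exact key _ _ _ _ (by simp; omega) hu hd hr hl fun b hb => by
        rcases hnbr b hb with h | h | h | h <;> simp [h]
  obtain ⟨x, y, hne, hx, hy, hall⟩ := hpair
  have hset : {b : ℤ × ℤ | dualBdryAdj V (c, d) b} = {x, y} := by
    ext b
    refine ⟨hall b, ?_⟩
    rintro (rfl | rfl)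
    exacts [hx, hy]
  rw [hset, Set.encard_pair hne]
end

section
/- Let d ≥ 1 and define the directed graph 𝔾₀ on ℤ^d as follows: for nonzero x in the orthant 𝖮 = {x ∈ ℤ^d : x·e_i ≥ 0 for all i}, let k(x) = min{k ≥ 1 : x/2^k ∉ ℤ^d} and let i(x) be the largest index i such that (x/2^{k(x)−1})·e_i is odd; the edges of 𝔾₀ are exactly ⟨x, x − e_{i(x)}⟩ for nonzero x ∈ 𝖮. For every k ≥ 1, every z ∈ 𝖮, and every x ∈ 2^k z + C_k where C_k = {0, …, 2^k − 1}^d, the directed path started at x obtained by repeatedly following out-edges of 𝔾₀ reaches the vertex 2^k z within d·2^k steps, and all vertices of the path up to that point lie in 2^k z + C_k. -/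
/-- The dyadic directed graph `𝔾₀` on `ℤ^d`: there is an edge `⟨x, x − e_{i(x)}⟩` for
every nonzero `x` in the orthant `𝖮 = {x : x_j ≥ 0 ∀j}`, where
`k(x) = min {k ≥ 1 : x/2^k ∉ ℤ^d}` (equivalently, `2^{k-1}` divides every coordinate of
`x` but `2^k` does not) and `i(x)` is the largest index `i` such that
`(x/2^{k(x)-1})·e_i` is odd (equivalently, such that `2^{k(x)}` does not divide `x_i`). -/
def dyadicEdge {d : ℕ} (x y : Fin d → ℤ) : Prop :=
  (∀ j, 0 ≤ x j) ∧ x ≠ 0 ∧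
  ∃ (k : ℕ) (i : Fin d), 1 ≤ k ∧
    (∀ j, (2 : ℤ) ^ (k - 1) ∣ x j) ∧
    ¬ (2 : ℤ) ^ k ∣ x i ∧
    (∀ j, ¬ (2 : ℤ) ^ k ∣ x j → j ≤ i) ∧
    y = Function.update x i (x i - 1)

/-- Every nonzero vertex of the orthant has an out-edge. -/
theorem exists_dyadicEdge {d : ℕ} {x : Fin d → ℤ} (h_nonneg : ∀ j, 0 ≤ x j) (h_ne : x ≠ 0) :
    ∃ y, dyadicEdge x y := by
  classical
  obtain ⟨a, ha⟩ := Function.ne_iff.mp h_ne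
  have h_exists : ∃ k, ∃ j, ¬ (2 : ℤ) ^ k ∣ x j := by
    refine ⟨(x a).toNat, a, fun h => ?_⟩
    have h_pos : 0 < x a := lt_of_le_of_ne (h_nonneg a) (Ne.symm ha)
    have h_le := Int.le_of_dvd h_pos h
    have h_lt : ((x a).toNat : ℤ) < 2 ^ (x a).toNat := by
      exact_mod_cast Nat.lt_two_pow_self
    omega
  set k := Nat.find h_exists with hk
  obtain ⟨b, hb⟩ := Nat.find_spec h_exists
  have hk_pos : 1 ≤ k := by
    rw [Nat.one_le_iff_ne_zero]
    intro h
    rw [← hk, h] at hb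
    simp at hb
  have h_nonempty : (Finset.univ.filter fun j => ¬ (2 : ℤ) ^ k ∣ x j).Nonempty :=
    ⟨b, by simpa using hb⟩
  refine ⟨_, h_nonneg, h_ne, k, Finset.max' _ h_nonempty, hk_pos, fun j => ?_, ?_, fun j hj => ?_,
    rfl⟩
  · by_contra h
    exact Nat.find_min h_exists (show k - 1 < k by omega) ⟨j, h⟩
  · exact (Finset.mem_filter.mp (Finset.max'_mem _ h_nonempty)).2
  · exact Finset.le_max' _ _ (by simpa using hj)

/-- An out-edge from a vertex of a dyadic box other than its corner decrements a coordinate lying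
strictly above that of the corner. -/
theorem dyadicEdge.exists_update {d : ℕ} {x y : Fin d → ℤ} (h : dyadicEdge x y) {k : ℕ}
    {z : Fin d → ℤ} (hx : ∀ j, 2 ^ k * z j ≤ x j ∧ x j < 2 ^ k * (z j + 1))
    (h_ne : x ≠ fun j => 2 ^ k * z j) :
    ∃ i, 2 ^ k * z i < x i ∧ y = Function.update x i (x i - 1) := by
  obtain ⟨-, -, l, i, -, h_dvd, h_not_dvd, -, rfl⟩ := h
  refine ⟨i, lt_of_le_of_ne (hx i).1 fun h_eq => h_ne ?_, rfl⟩
  have h_lt : k < l := by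
    by_contra! h
    exact h_not_dvd (h_eq ▸ (pow_dvd_pow 2 h).mul_right _)
  funext j
  obtain ⟨c, hc⟩ := (pow_dvd_pow (2 : ℤ) (Nat.le_sub_one_of_lt h_lt)).trans (h_dvd j)
  have h_pow : (0 : ℤ) < 2 ^ k := by positivity
  obtain ⟨h_lower, h_upper⟩ := hx j
  rw [hc] at h_lower h_upper
  have h_le := le_of_mul_le_mul_left h_lower h_pow
  have h_lt' := lt_of_mul_lt_mul_left h_upper h_pow.le
  rw [hc, show c = z j by omega]

/-- From a vertex of a dyadic box, the out-edges lead to the corner of the box in as many steps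
as the `ℓ¹` distance to the corner, without leaving the box. -/
theorem exists_dyadicEdge_path {d k : ℕ} {z : Fin d → ℤ} (hz : ∀ j, 0 ≤ z j) (m : ℕ)
    (x : Fin d → ℤ) (hx : ∀ j, 2 ^ k * z j ≤ x j ∧ x j < 2 ^ k * (z j + 1))
    (h_sum : ∑ j, (x j - 2 ^ k * z j) = m) :
    ∃ f : ℕ → Fin d → ℤ,
      f 0 = x ∧
      (∀ n < m, dyadicEdge (f n) (f (n + 1))) ∧
      (f m = fun j => 2 ^ k * z j) ∧
      ∀ n ≤ m, ∀ j, 2 ^ k * z j ≤ f n j ∧ f n j < 2 ^ k * (z j + 1) := by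
  induction m generalizing x with
  | zero =>
    refine ⟨fun _ => x, rfl, by simp, ?_, fun _ _ => hx⟩
    funext j
    have h := (Finset.sum_eq_zero_iff_of_nonneg fun j _ => sub_nonneg.mpr (hx j).1).mp
      (by simpa using h_sum) j (Finset.mem_univ j)
    simpa [sub_eq_zero] using h
  | succ m ih =>
    have h_ne : x ≠ fun j => 2 ^ k * z j := by
      rintro rfl
      simp at h_sum
      omega
    have h_corner : ∀ j, 0 ≤ 2 ^ k * z j := fun j => mul_nonneg (by positivity) (hz j)
    have h_zero : x ≠ 0 := by
      rintro rfl
      exact h_ne (funext fun j => le_antisymm (h_corner j) (hx j).1)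
    obtain ⟨y, hy⟩ := exists_dyadicEdge (fun j => (h_corner j).trans (hx j).1) h_zero
    obtain ⟨i, hi, rfl⟩ := hy.exists_update hx h_ne
    obtain ⟨f, hf_zero, hf_edge, hf_end, hf_box⟩ := ih (Function.update x i (x i - 1))
      (fun j => by
        rcases eq_or_ne j i with rfl | hj
        · have := hx j
          simp only [Function.update_self]
          omega
        · simpa [hj] using hx j)
      (by
        rw [Finset.sum_sub_distrib, Finset.sum_update_of_mem (Finset.mem_univ i)]
        rw [Finset.sum_sub_distrib,
          Finset.sum_eq_add_sum_sdiff_singleton_of_mem (Finset.mem_univ i) x] at h_sum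
        push_cast at h_sum
        linarith)
    refine ⟨fun n => Nat.casesOn n x f, rfl, ?_, hf_end, ?_⟩
    · rintro (_ | n) hn
      · simpa [hf_zero] using hy
      · exact hf_edge n (by omega)
    · rintro (_ | n) hn
      · exact hx
      · exact hf_box n (by omega)

/-- **Lemma.** For every `k ≥ 1`, every `z` in the orthant, and every
`x ∈ 2^k z + C_k` (`C_k = {0, …, 2^k − 1}^d`), the directed path started at `x` obtained
by following out-edges of `𝔾₀` reaches `2^k z` within `d·2^k` steps, staying inside
`2^k z + C_k` up to that point. -/
theorem dyadic_path_reaches_box_corner (d : ℕ) (hd : 1 ≤ d)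
    (k : ℕ) (hk : 1 ≤ k) (z : Fin d → ℤ) (hz : ∀ j, 0 ≤ z j)
    (x : Fin d → ℤ) (hx : ∀ j, 2 ^ k * z j ≤ x j ∧ x j < 2 ^ k * (z j + 1)) :
    ∃ (f : ℕ → Fin d → ℤ) (m : ℕ),
      f 0 = x ∧ m ≤ d * 2 ^ k ∧
      (∀ n < m, dyadicEdge (f n) (f (n + 1))) ∧
      (f m = fun j => 2 ^ k * z j) ∧
      ∀ n ≤ m, ∀ j, 2 ^ k * z j ≤ f n j ∧ f n j < 2 ^ k * (z j + 1) := by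
  have h_nonneg : 0 ≤ ∑ j, (x j - 2 ^ k * z j) :=
    Finset.sum_nonneg fun j _ => sub_nonneg.mpr (hx j).1
  obtain ⟨m, hm⟩ := Int.eq_ofNat_of_zero_le h_nonneg
  obtain ⟨f, hf_zero, hf_edge, hf_end, hf_box⟩ := exists_dyadicEdge_path hz m x hx hm
  refine ⟨f, m, hf_zero, ?_, hf_edge, hf_end, hf_box⟩
  have h_le : ∑ j, (x j - 2 ^ k * z j) ≤ ∑ _j : Fin d, (2 : ℤ) ^ k :=
    Finset.sum_le_sum fun j _ => by linarith [(hx j).2]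
  rw [hm] at h_le
  simp only [Finset.sum_const, Finset.card_univ, Fintype.card_fin, nsmul_eq_mul] at h_le
  exact_mod_cast h_le
end

section
/- Let d ≥ 1 and let 𝔾₀ be the directed graph on ℤ^d whose edges are ⟨x, x − e_{i(x)}⟩ for nonzero x in the orthant 𝖮 = {x ∈ ℤ^d : x·e_i ≥ 0 for all i}, where k(x) = min{k ≥ 1 : x/2^k ∉ ℤ^d} and i(x) is the largest index i such that (x/2^{k(x)−1})·e_i is odd. Let k ≥ 1, z ∈ 𝖮, and suppose x ∈ 2^k z + C_k, where C_k = {0, …, 2^k − 1}^d, has at least two coordinates that are not multiples of 2^k. Then every vertex y with a directed path from y to x in 𝔾₀ lies in 2^k z + C_k. -/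
/-- If at least two coordinates of `x` are not multiples of `2 ^ k`, then an edge from `y` to `x`
decrements a coordinate of `y` that is not a multiple of `2 ^ k`. -/
theorem dyadicEdge.exists_eq_update_not_dvd {d k : ℕ} {x y : Fin d → ℤ} (h : dyadicEdge y x)
    (htwo : ∃ i j : Fin d, i ≠ j ∧ ¬ (2 : ℤ) ^ k ∣ x i ∧ ¬ (2 : ℤ) ^ k ∣ x j) :
    ∃ i, x = Function.update y i (y i - 1) ∧ ¬ (2 : ℤ) ^ k ∣ y i := by
  obtain ⟨-, -, m, i, hm, hdvd, hi, -, rfl⟩ := h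
  refine ⟨i, rfl, fun hki => hi ?_⟩
  obtain ⟨j, hji, hj⟩ : ∃ j, j ≠ i ∧ ¬ (2 : ℤ) ^ k ∣ Function.update y i (y i - 1) j := by
    obtain ⟨a, b, hab, ha, hb⟩ := htwo
    by_cases hai : a = i
    · exact ⟨b, fun hbi => hab (hai.trans hbi.symm), hb⟩
    · exact ⟨a, hai, ha⟩
  rw [Function.update_of_ne hji] at hj
  have hmk : m ≤ k := by
    by_contra! hkm
    exact hj ((pow_dvd_pow 2 (by lia)).trans (hdvd j))
  exact (pow_dvd_pow 2 hmk).trans hki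

/-- **Lemma.** Let `k ≥ 1`, let `z` be in the orthant, and let `x ∈ 2^k z + C_k`
(`C_k = {0, …, 2^k − 1}^d`) have at least two coordinates that are not multiples of
`2^k`.  Then every vertex `y` with a directed path from `y` to `x` in `𝔾₀` lies in
`2^k z + C_k`. -/
theorem dyadic_backward_cluster_in_box (d : ℕ) (hd : 1 ≤ d)
    (k : ℕ) (hk : 1 ≤ k) (z : Fin d → ℤ) (hz : ∀ j, 0 ≤ z j)
    (x : Fin d → ℤ) (hx : ∀ j, 2 ^ k * z j ≤ x j ∧ x j < 2 ^ k * (z j + 1))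
    (htwo : ∃ i j : Fin d, i ≠ j ∧ ¬ (2 : ℤ) ^ k ∣ x i ∧ ¬ (2 : ℤ) ^ k ∣ x j) :
    ∀ y : Fin d → ℤ, Relation.ReflTransGen dyadicEdge y x →
      ∀ j, 2 ^ k * z j ≤ y j ∧ y j < 2 ^ k * (z j + 1) := by
  intro y hyx
  suffices h : (∀ j, 2 ^ k * z j ≤ y j ∧ y j < 2 ^ k * (z j + 1)) ∧
      ∃ i j : Fin d, i ≠ j ∧ ¬ (2 : ℤ) ^ k ∣ y i ∧ ¬ (2 : ℤ) ^ k ∣ y j from h.1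
  induction hyx using Relation.ReflTransGen.head_induction_on with
  | refl => exact ⟨hx, htwo⟩
  | @head y w hyw _ ih =>
    obtain ⟨hbox, hw⟩ := ih
    obtain ⟨i, rfl, hi⟩ := hyw.exists_eq_update_not_dvd hw
    have hmono (j : Fin d) (hj : ¬ (2 : ℤ) ^ k ∣ Function.update y i (y i - 1) j) :
        ¬ (2 : ℤ) ^ k ∣ y j := by
      by_cases hji : j = i
      · exact hji ▸ hi
      · rwa [Function.update_of_ne hji] at hj
    refine ⟨fun j => ?_, ?_⟩
    · have hj := hbox j
      by_cases hji : j = i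
      · subst hji
        rw [Function.update_self] at hj
        have hne : y j ≠ 2 ^ k * (z j + 1) := fun h => hi (h ▸ dvd_mul_right _ _)
        exact ⟨by lia, lt_of_le_of_ne (by lia) hne⟩
      · rwa [Function.update_of_ne hji] at hj
    · obtain ⟨a, b, hab, ha, hb⟩ := hw
      exact ⟨a, b, hab, hmono a ha, hmono b hb⟩
end
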